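/- Let d ≥ 1 and 0 ≤ m < d be integers. There exists N such that for every integer n ≥ N and every coloring of the n^d small cubes of the standard partition of the unit cube in m+1 colors, there exists a monochromatic connected component containing at least n^{d−m} / ((m+1)! · binom(d,m) · 4^m) small cubes. -/

import Mathlib

/-- Two small cubes of the standard partition of `[0,1]^d` into `n^d` cubes are
adjacent iff their closed cubes intersect, i.e. iff `|a i - b i| ≤ 1` for every
coordinate `i`. -/
def cubeAdj {d n : ℕ} (a b : Fin d → Fin n) : Prop :=
  ∀ i : Fin d, (a i : ℤ) ≤ (b i : ℤ) + 1 ∧ (b i : ℤ) ≤ (a i : ℤ) + 1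

/-- The monochromatic connected component (for the coloring `χ`) containing the
small cube indexed by `a`: all cubes reachable from `a` by a chain of adjacent
cubes in which consecutive cubes have the same color. -/
def monoComponent {d n : ℕ} {α : Type*} (χ : (Fin d → Fin n) → α) (a : Fin d → Fin n) :
    Set (Fin d → Fin n) :=
  {b | Relation.ReflTransGen (fun x y => cubeAdj x y ∧ χ x = χ y) a b}

section CubeColoring

open Finset Function

section CubicalCochains

variable {ι : Type*} [DecidableEq ι]

/-- Mod 2 cubical cochains on the grid `ℕ^ι`: the face with directions `S` and lowest vertex `x`
is the one spanned by the vertices `x + 1_T`, `T ⊆ S`. -/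
abbrev CubicalCochain (ι : Type*) := Finset ι → (ι → ℕ) → ZMod 2

/-- The vertex `x + e_i`. -/
def gridStep (i : ι) (x : ι → ℕ) : ι → ℕ := update x i (x i + 1)

theorem gridStep_comm (i j : ι) (x : ι → ℕ) :
    gridStep i (gridStep j x) = gridStep j (gridStep i x) := by
  by_cases h : i = j
  · rw [h]
  · rw [gridStep, gridStep, gridStep, gridStep, update_of_ne h, update_of_ne (Ne.symm h),
      update_comm h]

theorem gridStep_update_of_ne {i j : ι} (h : j ≠ i) (x : ι → ℕ) (s : ℕ) :
    gridStep j (update x i s) = update (gridStep j x) i s := by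
  rw [gridStep, gridStep, update_of_ne h, update_comm h]

/-- The mod 2 cubical coboundary. -/
def coboundary (f : CubicalCochain ι) : CubicalCochain ι := fun S x =>
  ∑ i ∈ S, (f (S.erase i) x + f (S.erase i) (gridStep i x))

theorem coboundary_add (f g : CubicalCochain ι) :
    coboundary (f + g) = coboundary f + coboundary g := by
  ext S x
  simp only [coboundary, Pi.add_apply, ← sum_add_distrib]
  exact sum_congr rfl fun _ _ => by ring

theorem coboundary_zero : coboundary (0 : CubicalCochain ι) = 0 := by
  ext S x
  simp [coboundary]

theorem coboundary_sum {κ : Type*} (T : Finset κ) (f : κ → CubicalCochain ι) :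
    coboundary (∑ j ∈ T, f j) = ∑ j ∈ T, coboundary (f j) := by
  classical
  induction T using Finset.induction_on with
  | empty => simp [coboundary_zero]
  | insert a T ha ih => rw [sum_insert ha, sum_insert ha, coboundary_add, ih]

/-- The cochain `f` is concentrated in dimension `p`. -/
def IsHomogeneousCochain (p : ℕ) (f : CubicalCochain ι) : Prop :=
  ∀ S x, f S x ≠ 0 → S.card = p

/-- Sweeping in direction `i` towards the hyperplane `x i = t`. -/
def sweep (i : ι) (t : ℕ) (f : CubicalCochain ι) : CubicalCochain ι := fun S x =>
  if i ∈ S then 0 else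
    ∑ s ∈ range (x i), f (insert i S) (update x i s) +
      ∑ s ∈ range t, f (insert i S) (update x i s)

/-- Restriction to the hyperplane `x i = t`, extended constantly in direction `i`. -/
def retract (i : ι) (t : ℕ) (f : CubicalCochain ι) : CubicalCochain ι := fun S x =>
  if i ∈ S then 0 else f S (update x i t)

theorem coboundary_retract (i : ι) (t : ℕ) (f : CubicalCochain ι) :
    coboundary (retract i t f) = retract i t (coboundary f) := by
  ext S x
  by_cases hi : i ∈ S
  · simp only [coboundary, retract, if_pos hi]
    refine sum_eq_zero fun j hj => ?_
    by_cases hji : j = i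
    · subst hji
      simp [gridStep, CharTwo.add_self_eq_zero]
    · simp [mem_erase, hi, Ne.symm hji]
  · simp only [coboundary, retract, if_neg hi]
    refine sum_congr rfl fun j hj => ?_
    have hji : j ≠ i := fun h => hi (h ▸ hj)
    have hi' : i ∉ S.erase j := fun h => hi (mem_of_mem_erase h)
    rw [if_neg hi', if_neg hi', gridStep_update_of_ne hji]

theorem sum_range_add_succ (u : ℕ → ZMod 2) (n : ℕ) :
    ∑ s ∈ range n, (u s + u (s + 1)) = u 0 + u n := by
  induction n with
  | zero => simp [CharTwo.add_self_eq_zero]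
  | succ n ih =>
    rw [sum_range_succ, ih, add_add_add_comm, ← add_assoc, add_assoc (u 0),
      CharTwo.add_self_eq_zero, add_zero]

/-- `sweep` is a chain homotopy between the identity and `retract`; here for cocycles. -/
theorem coboundary_sweep (i : ι) (t : ℕ) {f : CubicalCochain ι} (hf : coboundary f = 0) :
    coboundary (sweep i t f) = f + retract i t f := by
  ext S x
  by_cases hi : i ∈ S
  · simp only [Pi.add_apply, retract, if_pos hi, add_zero]
    rw [coboundary, sum_eq_single_of_mem i hi]
    · simp only [sweep, notMem_erase, if_false, insert_erase hi, gridStep, update_self,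
        update_idem, sum_range_succ, update_eq_self]
      linear_combination (∑ s ∈ range (x i), f S (update x i s) +
        ∑ s ∈ range t, f S (update x i s)) * (CharTwo.two_eq_zero (R := ZMod 2))
    · intro j _ hji
      simp [sweep, hi, Ne.symm hji]
  · have key : ∀ s, f S (update x i s) + f S (update x i (s + 1)) =
        ∑ j ∈ S, (f (insert i (S.erase j)) (update x i s) +
          f (insert i (S.erase j)) (update (gridStep j x) i s)) := by
      intro s
      have h := congrFun (congrFun hf (insert i S)) (update x i s)
      rw [coboundary, sum_insert hi, erase_insert hi] at h
      have h2 : gridStep i (update x i s) = update x i (s + 1) := by simp [gridStep]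
      rw [h2] at h
      rw [← sub_eq_zero, CharTwo.sub_eq_add]
      refine Eq.trans ?_ h
      congr 1
      refine sum_congr rfl fun j hj => ?_
      have hji : j ≠ i := fun h => hi (h ▸ hj)
      rw [gridStep_update_of_ne hji, erase_insert_of_ne hji.symm]
    have lhs : coboundary (sweep i t f) S x =
        ∑ s ∈ range (x i), (f S (update x i s) + f S (update x i (s + 1))) +
          ∑ s ∈ range t, (f S (update x i s) + f S (update x i (s + 1))) := by
      simp_rw [key]
      rw [sum_comm, sum_comm (s := range t), ← sum_add_distrib]
      refine sum_congr rfl fun j hj => ?_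
      have hji : j ≠ i := fun h => hi (h ▸ hj)
      have hi' : i ∉ S.erase j := fun h => hi (mem_of_mem_erase h)
      have hx : gridStep j x i = x i := by simp [gridStep, hji.symm]
      simp only [sweep, if_neg hi', hx, sum_add_distrib]
      ring
    rw [lhs, sum_range_add_succ (fun s => f S (update x i s)),
      sum_range_add_succ (fun s => f S (update x i s))]
    simp only [Pi.add_apply, retract, if_neg hi, update_eq_self]
    linear_combination f S (update x i 0) * (CharTwo.two_eq_zero (R := ZMod 2))

variable [Fintype ι]

/-- The faces with lowest vertex in `[0, n)^ι` on which `f` does not vanish. -/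
def cochainSupport (n : ℕ) (f : CubicalCochain ι) : Finset (Finset ι × (ι → ℕ)) :=
  (univ ×ˢ Fintype.piFinset fun _ => range n).filter fun q => f q.1 q.2 ≠ 0

theorem mem_cochainSupport {n : ℕ} {f : CubicalCochain ι} {q : Finset ι × (ι → ℕ)} :
    q ∈ cochainSupport n f ↔ (∀ i, q.2 i < n) ∧ f q.1 q.2 ≠ 0 := by
  simp [cochainSupport]

theorem card_cochainSupport_add_le (n : ℕ) (f g : CubicalCochain ι) :
    (cochainSupport n (f + g)).card ≤ (cochainSupport n f).card + (cochainSupport n g).card := by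
  refine (card_le_card ?_).trans (card_union_le _ _)
  intro q hq
  simp only [mem_union, mem_cochainSupport, Pi.add_apply] at hq ⊢
  by_contra! h
  exact hq.2 (by rw [h.1 hq.1, h.2 hq.1, add_zero])

theorem card_cochainSupport_sum_le {κ : Type*} (n : ℕ) (T : Finset κ) (f : κ → CubicalCochain ι) :
    (cochainSupport n (∑ j ∈ T, f j)).card ≤ ∑ j ∈ T, (cochainSupport n (f j)).card := by
  classical
  induction T using Finset.induction_on with
  | empty => simp [cochainSupport]
  | insert a T ha ih =>
    rw [sum_insert ha, sum_insert ha]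
    exact (card_cochainSupport_add_le _ _ _).trans (by gcongr)

theorem card_cochainSupport_sweep_le {n t : ℕ} (ht : t < n) (i : ι) (f : CubicalCochain ι) :
    (cochainSupport n (sweep i t f)).card ≤
      n * ((cochainSupport n f).filter fun q => i ∈ q.1).card := by
  have hsub : cochainSupport n (sweep i t f) ⊆
      (range n ×ˢ (cochainSupport n f).filter fun q => i ∈ q.1).image
        fun r => (r.2.1.erase i, update r.2.2 i r.1) := by
    rintro ⟨S, x⟩ hq
    rw [mem_cochainSupport] at hq
    obtain ⟨hx, hne⟩ := hq
    dsimp only at hx hne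
    have hi : i ∉ S := fun h => hne (by simp [sweep, h])
    obtain ⟨s, hs, hsne⟩ : ∃ s < n, f (insert i S) (update x i s) ≠ 0 := by
      by_contra! h
      refine hne ?_
      rw [sweep, if_neg hi, sum_eq_zero, sum_eq_zero, add_zero]
      · exact fun s hs => h s ((mem_range.1 hs).trans ht)
      · exact fun s hs => h s ((mem_range.1 hs).trans (hx i))
    refine mem_image.2 ⟨(x i, (insert i S, update x i s)), ?_, ?_⟩
    · simp only [mem_product, mem_range, mem_filter, mem_cochainSupport, mem_insert_self, and_true]
      refine ⟨hx i, fun j => ?_, hsne⟩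
      by_cases hj : j = i
      · subst hj; simpa using hs
      · simpa [hj] using hx j
    · simp [erase_insert hi]
  refine (card_le_card hsub).trans (card_image_le.trans ?_)
  rw [card_product, card_range]

theorem exists_card_cochainSupport_retract_le {n : ℕ} (hn : 0 < n) (i : ι)
    (f : CubicalCochain ι) :
    ∃ t < n, (cochainSupport n (retract i t f)).card ≤
      ((cochainSupport n f).filter fun q => i ∉ q.1).card := by
  have hsum : ∑ t ∈ range n, (cochainSupport n (retract i t f)).card ≤
      ∑ _t ∈ range n, ((cochainSupport n f).filter fun q => i ∉ q.1).card := by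
    rw [← card_sigma, sum_const, card_range, smul_eq_mul, ← card_range n, ← card_product,
      card_range]
    refine card_le_card_of_injOn (fun r => (r.2.2 i, (r.2.1, update r.2.2 i r.1))) ?_ ?_
    · rintro ⟨t, S, x⟩ h
      simp only [coe_sigma, Set.mem_sigma_iff, mem_coe, mem_range, mem_cochainSupport] at h
      obtain ⟨ht, hx, hne⟩ := h
      have hi : i ∉ S := fun h => hne (by simp [retract, h])
      rw [retract, if_neg hi] at hne
      simp only [coe_product, Set.mem_prod, mem_coe, mem_range, mem_filter, mem_cochainSupport]
      refine ⟨hx i, ⟨fun j => ?_, hne⟩, hi⟩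
      by_cases hj : j = i
      · subst hj; simpa using ht
      · simpa [hj] using hx j
    · rintro ⟨t, S, x⟩ - ⟨t', S', x'⟩ - h
      simp only [Prod.mk.injEq] at h
      obtain ⟨h1, rfl, h2⟩ := h
      have h3 : t = t' := by simpa using congrFun h2 i
      have h4 : x = x' := by
        ext j
        by_cases hj : j = i
        · rw [hj, h1]
        · simpa [hj] using congrFun h2 j
      rw [h3, h4]
  obtain ⟨t, ht, h⟩ := exists_le_of_sum_le (nonempty_range_iff.2 hn.ne') hsum
  exact ⟨t, mem_range.1 ht, h⟩

theorem exists_filling_of_directions {n : ℕ} (hn : 0 < n) (p : ℕ) (U : Finset ι) :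
    ∀ f : CubicalCochain ι, IsHomogeneousCochain (p + 1) f → coboundary f = 0 →
      (∀ S x, f S x ≠ 0 → S ⊆ U) →
      ∃ b, coboundary b = f ∧ IsHomogeneousCochain p b ∧
        (cochainSupport n b).card ≤ n * (cochainSupport n f).card := by
  induction U using Finset.induction_on with
  | empty =>
    intro f hp _ hU
    have hf0 : f = 0 := by
      ext S x
      by_contra h
      have h1 := hp S x h
      rw [subset_empty.1 (hU S x h)] at h1
      simp at h1
    refine ⟨0, by rw [coboundary_zero, hf0], fun S x h => (h rfl).elim, ?_⟩
    simp [cochainSupport]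
  | insert i U _ ih =>
    intro f hp hf hU
    obtain ⟨t, ht, hcard⟩ := exists_card_cochainSupport_retract_le hn i f
    obtain ⟨b, hb, hbp, hbn⟩ := ih (retract i t f) (by
        intro S x h
        by_cases hi : i ∈ S
        · simp [retract, hi] at h
        · rw [retract, if_neg hi] at h
          exact hp _ _ h)
      (by rw [coboundary_retract, hf]; ext; simp [retract]) (by
        intro S x h
        by_cases hi : i ∈ S
        · simp [retract, hi] at h
        · rw [retract, if_neg hi] at h
          exact (subset_insert_iff_of_notMem hi).1 (hU _ _ h))
    refine ⟨sweep i t f + b, ?_, ?_, ?_⟩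
    · rw [coboundary_add, coboundary_sweep i t hf, hb, add_assoc]
      ext S x
      simp [CharTwo.add_self_eq_zero]
    · intro S x h
      by_contra hS
      have h1 : b S x = 0 := by
        by_contra h2
        exact hS (hbp _ _ h2)
      rw [Pi.add_apply, Pi.add_apply, h1, add_zero] at h
      by_cases hi : i ∈ S
      · simp [sweep, hi] at h
      · rw [sweep, if_neg hi] at h
        have h3 : ∀ y, f (insert i S) y = 0 := by
          intro y
          by_contra h4
          have h5 := hp _ _ h4
          rw [card_insert_of_notMem hi] at h5
          omega
        simp [h3] at h
    · have h1 := card_cochainSupport_sweep_le ht i f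
      have h2 := card_cochainSupport_add_le n (sweep i t f) b
      have h3 := card_filter_add_card_filter_not (s := cochainSupport n f) fun q => i ∈ q.1
      have h4 := Nat.mul_le_mul_left n hcard
      rw [← h3, mul_add]
      omega

/-- The linear isoperimetric inequality in the cube of side `n`. -/
theorem exists_filling {n : ℕ} (hn : 0 < n) (p : ℕ) (f : CubicalCochain ι)
    (hp : IsHomogeneousCochain (p + 1) f) (hf : coboundary f = 0) :
    ∃ b, coboundary b = f ∧ IsHomogeneousCochain p b ∧
      (cochainSupport n b).card ≤ n * (cochainSupport n f).card :=
  exists_filling_of_directions hn p univ f hp hf fun _ _ _ => subset_univ _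

theorem eq_apply_zero_of_coboundary_eq_zero {f : CubicalCochain ι} (hf : coboundary f = 0)
    (x : ι → ℕ) : f ∅ x = f ∅ 0 := by
  induction hk : ∑ i, x i generalizing x with
  | zero =>
    have : x = 0 := by
      ext i
      exact (sum_eq_zero_iff.1 hk) i (mem_univ i)
    rw [this]
  | succ k ih =>
    obtain ⟨i, hi⟩ : ∃ i, x i ≠ 0 := by
      by_contra! h
      simp [h] at hk
    have hx : gridStep i (update x i (x i - 1)) = x := by
      simp [gridStep, Nat.sub_add_cancel (Nat.pos_of_ne_zero hi)]
    have h := congrFun (congrFun hf {i}) (update x i (x i - 1))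
    simp only [coboundary, sum_singleton, erase_singleton, hx, Pi.zero_apply] at h
    rw [← ih (update x i (x i - 1)) ?_]
    · rw [eq_comm, ← sub_eq_zero, CharTwo.sub_eq_add, h]
    · rw [sum_update_of_mem (mem_univ i)]
      rw [← add_sum_erase _ _ (mem_univ i), erase_eq] at hk
      omega

end CubicalCochains

section Labelings

variable {ι L : Type*} [DecidableEq ι] [DecidableEq L]

theorem sum_sum_erase_eq_zero {κ : Type*} [DecidableEq κ] (T : Finset κ) (g : κ → κ → ZMod 2)
    (hg : ∀ i j, g i j = g j i) : ∑ i ∈ T, ∑ j ∈ T.erase i, g i j = 0 := by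
  rw [sum_sigma']
  refine sum_involution (fun q _ => ⟨q.2, q.1⟩) ?_ ?_ ?_ ?_
  · rintro ⟨i, j⟩ _
    rw [hg i j, CharTwo.add_self_eq_zero]
  · rintro ⟨i, j⟩ h _ heq
    simp only [mem_sigma, mem_erase] at h
    simp only [Sigma.mk.injEq, heq_eq_eq] at heq
    exact h.2.1 heq.1
  · rintro ⟨i, j⟩ h
    simp only [mem_sigma, mem_erase] at h ⊢
    exact ⟨h.2.2, h.2.1.symm, h.1⟩
  · rintro ⟨i, j⟩ _
    rfl

/-- For a labeling `ℓ` of the grid, the number mod 2 of the monotone lattice paths through a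
`k`-dimensional face whose vertices carry each label of `I` exactly once. -/
def labelCochain (ℓ : (ι → ℕ) → L) : ℕ → Finset L → Finset ι → (ι → ℕ) → ZMod 2
  | 0, I, S, x => if S = ∅ ∧ I = {ℓ x} then 1 else 0
  | k + 1, I, S, x =>
    if ℓ x ∈ I then ∑ i ∈ S, labelCochain ℓ k (I.erase (ℓ x)) (S.erase i) (gridStep i x) else 0

theorem labelCochain_eq_zero {ℓ : (ι → ℕ) → L} {I : Finset L} {x : ι → ℕ} (h : ℓ x ∉ I) (k : ℕ)
    (S : Finset ι) : labelCochain ℓ k I S x = 0 := by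
  cases k with
  | zero =>
    rw [labelCochain, if_neg]
    rintro ⟨-, rfl⟩
    simp at h
  | succ k => rw [labelCochain, if_neg h]

section

variable [Fintype L]

theorem sum_labelCochain_zero (ℓ : (ι → ℕ) → L) (x : ι → ℕ) :
    ∑ v, labelCochain ℓ 0 {v} ∅ x = 1 := by
  simp [labelCochain]

theorem sum_compl_insert_eq {M : Type*} [AddCommGroup M] {I : Finset L} {v : L} (hv : v ∈ I)
    (g : Finset L → M) :
    ∑ j ∈ Iᶜ, g ((insert j I).erase v) = ∑ j ∈ (I.erase v)ᶜ, g (insert j (I.erase v)) - g I := by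
  rw [compl_erase, sum_insert (by simpa using hv), insert_erase hv, add_sub_cancel_left]
  refine sum_congr rfl fun j hj => ?_
  rw [erase_insert_of_ne]
  rintro rfl
  exact (mem_compl.1 hj) hv

/-- The cochains `labelCochain ℓ` form a chain map from the grid to the simplex on the labels. -/
theorem coboundary_labelCochain (ℓ : (ι → ℕ) → L) (k : ℕ) (I : Finset L) :
    coboundary (labelCochain ℓ k I) = ∑ j ∈ Iᶜ, labelCochain ℓ (k + 1) (insert j I) := by
  induction k generalizing I with
  | zero =>
    ext S x
    rw [Finset.sum_apply, Finset.sum_apply]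
    by_cases hx : ℓ x ∈ I
    · have h1 : ∀ j ∈ Iᶜ, labelCochain ℓ 1 (insert j I) S x =
          ∑ i ∈ S, labelCochain ℓ 0 ((insert j I).erase (ℓ x)) (S.erase i) (gridStep i x) := by
        intro j _
        rw [labelCochain, if_pos (mem_insert_of_mem hx)]
      rw [sum_congr rfl h1, sum_comm, coboundary]
      refine sum_congr rfl fun i _ => ?_
      rw [sum_compl_insert_eq hx fun J => labelCochain ℓ 0 J (S.erase i) (gridStep i x),
        CharTwo.sub_eq_add]
      congr 1
      simp only [labelCochain]
      by_cases hS : S.erase i = ∅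
      · simp only [hS, true_and]
        by_cases hI : I = {ℓ x}
        · simp [hI]
        · rw [if_neg hI, sum_eq_zero]
          intro j hj
          rw [if_neg]
          intro h
          have h2 : (I.erase (ℓ x)).card = 0 := by
            have := congrArg Finset.card h
            rw [card_insert_of_notMem (mem_compl.1 hj), card_singleton] at this
            omega
          rw [card_eq_zero, erase_eq_empty_iff] at h2
          rcases h2 with rfl | h2
          · simp at hx
          · exact hI h2
      · simp [hS]
    · have h1 : ∀ j ∈ Iᶜ, j ≠ ℓ x → labelCochain ℓ 1 (insert j I) S x = 0 := by
        intro j _ hj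
        exact labelCochain_eq_zero (by simp [hx, hj.symm]) _ _
      rw [sum_eq_single_of_mem (ℓ x) (mem_compl.2 hx) h1, coboundary, labelCochain,
        if_pos (mem_insert_self _ _), erase_insert hx]
      refine sum_congr rfl fun i _ => ?_
      rw [labelCochain_eq_zero hx, zero_add]
  | succ k ih =>
    ext S x
    rw [Finset.sum_apply, Finset.sum_apply]
    by_cases hx : ℓ x ∈ I
    · have h1 : ∀ j ∈ Iᶜ, labelCochain ℓ (k + 2) (insert j I) S x =
          ∑ i ∈ S, labelCochain ℓ (k + 1) ((insert j I).erase (ℓ x)) (S.erase i)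
            (gridStep i x) := by
        intro j _
        rw [labelCochain, if_pos (mem_insert_of_mem hx)]
      have h2 : ∀ i ∈ S, ∑ j ∈ Iᶜ, labelCochain ℓ (k + 1) ((insert j I).erase (ℓ x)) (S.erase i)
          (gridStep i x) = coboundary (labelCochain ℓ k (I.erase (ℓ x))) (S.erase i) (gridStep i x)
            + labelCochain ℓ (k + 1) I (S.erase i) (gridStep i x) := by
        intro i _
        rw [sum_compl_insert_eq hx fun J => labelCochain ℓ (k + 1) J (S.erase i) (gridStep i x),
          CharTwo.sub_eq_add, ih, Finset.sum_apply, Finset.sum_apply]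
      rw [sum_congr rfl h1, sum_comm, sum_congr rfl h2, coboundary, sum_add_distrib,
        sum_add_distrib]
      congr 1
      simp only [coboundary, sum_add_distrib]
      rw [sum_sum_erase_eq_zero S fun i j => labelCochain ℓ k (I.erase (ℓ x)) ((S.erase i).erase j)
        (gridStep j (gridStep i x)), add_zero]
      · have h3 : ∀ i ∈ S, labelCochain ℓ (k + 1) I (S.erase i) x =
            ∑ j ∈ S.erase i, labelCochain ℓ k (I.erase (ℓ x)) ((S.erase i).erase j)
              (gridStep j x) := by
          intro i _
          rw [labelCochain, if_pos hx]
        rw [sum_congr rfl h3, sum_comm' (t' := S) (s' := fun j => S.erase j)]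
        · refine sum_congr rfl fun i _ => sum_congr rfl fun j _ => ?_
          rw [erase_right_comm]
        · intro i j
          simp only [mem_erase]
          tauto
      · intro i j
        rw [erase_right_comm, gridStep_comm]
    · have h1 : ∀ j ∈ Iᶜ, j ≠ ℓ x → labelCochain ℓ (k + 2) (insert j I) S x = 0 := by
        intro j _ hj
        exact labelCochain_eq_zero (by simp [hx, hj.symm]) _ _
      rw [sum_eq_single_of_mem (ℓ x) (mem_compl.2 hx) h1, coboundary, labelCochain,
        if_pos (mem_insert_self _ _), erase_insert hx]
      refine sum_congr rfl fun i _ => ?_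
      rw [labelCochain_eq_zero hx, zero_add]

end

variable [Fintype ι]

/-- The vertices of the face `(S, x)`. -/
def faceVertices (S : Finset ι) (x : ι → ℕ) : Finset (ι → ℕ) :=
  S.powerset.image fun T i => if i ∈ T then x i + 1 else x i

theorem mem_faceVertices {S : Finset ι} {x y : ι → ℕ} :
    y ∈ faceVertices S x ↔ ∃ T ⊆ S, (fun i => if i ∈ T then x i + 1 else x i) = y := by
  simp [faceVertices]

theorem self_mem_faceVertices (S : Finset ι) (x : ι → ℕ) : x ∈ faceVertices S x :=
  mem_faceVertices.2 ⟨∅, empty_subset _, by simp⟩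

theorem faceVertices_erase_gridStep_subset {S : Finset ι} {i : ι} (hi : i ∈ S) (x : ι → ℕ) :
    faceVertices (S.erase i) (gridStep i x) ⊆ faceVertices S x := by
  intro y hy
  obtain ⟨T, hT, rfl⟩ := mem_faceVertices.1 hy
  refine mem_faceVertices.2 ⟨insert i T, insert_subset hi (hT.trans (erase_subset _ _)), ?_⟩
  have hiT : i ∉ T := fun h => notMem_erase i S (hT h)
  ext j
  by_cases hj : j = i
  · subst hj
    simp [hiT, gridStep]
  · simp [hj, gridStep]

theorem labelCochain_ne_zero {ℓ : (ι → ℕ) → L} {k : ℕ} {I : Finset L} {S : Finset ι}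
    {x : ι → ℕ} (h : labelCochain ℓ k I S x ≠ 0) :
    S.card = k ∧ I.card = k + 1 ∧ I ⊆ (faceVertices S x).image ℓ := by
  induction k generalizing I S x with
  | zero =>
    rw [labelCochain, ite_ne_right_iff] at h
    obtain ⟨⟨rfl, rfl⟩, -⟩ := h
    refine ⟨rfl, by simp, ?_⟩
    rw [singleton_subset_iff]
    exact mem_image_of_mem ℓ (self_mem_faceVertices _ _)
  | succ k ih =>
    rw [labelCochain, ite_ne_right_iff] at h
    obtain ⟨hx, h⟩ := h
    obtain ⟨i, hi, h⟩ := exists_ne_zero_of_sum_ne_zero h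
    obtain ⟨h1, h2, h3⟩ := ih h
    rw [card_erase_of_mem hi] at h1
    rw [card_erase_of_mem hx] at h2
    have := card_pos.2 ⟨i, hi⟩
    refine ⟨by omega, by omega, ?_⟩
    rw [← insert_erase hx, insert_subset_iff]
    exact ⟨mem_image_of_mem ℓ (self_mem_faceVertices _ _),
      h3.trans (image_subset_image (faceVertices_erase_gridStep_subset hi x))⟩

end Labelings

section Descent

variable {ι L : Type*} [DecidableEq ι] [Fintype ι] [DecidableEq L] [Fintype L]

/-- The total mass of the cochains `c I`, over the sets `I` with `p + 1` elements, including `v`. -/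
def mass (n : ℕ) (c : Finset L → CubicalCochain ι) (v : L) (p : ℕ) : ℕ :=
  ∑ I with v ∈ I ∧ I.card = p + 1, (cochainSupport n (c I)).card

theorem sum_sum_compl_insert (v : L) (p : ℕ) (g : Finset L → ℕ) :
    ∑ I with v ∈ I ∧ I.card = p + 1, ∑ j ∈ Iᶜ, g (insert j I) =
      (p + 1) * ∑ J with v ∈ J ∧ J.card = p + 2, g J := by
  have h : ∀ J ∈ ({J | v ∈ J ∧ J.card = p + 2} : Finset (Finset L)),
      (p + 1) * g J = ∑ _j ∈ J.erase v, g J := by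
    intro J hJ
    simp only [mem_filter, mem_univ, true_and] at hJ
    rw [sum_const, card_erase_of_mem hJ.1, hJ.2, smul_eq_mul]
    rfl
  rw [mul_sum, sum_congr rfl h, sum_sigma', sum_sigma']
  refine sum_bij' (fun q _ => ⟨insert q.2 q.1, q.2⟩) (fun q _ => ⟨q.1.erase q.2, q.2⟩)
    ?_ ?_ ?_ ?_ ?_
  · rintro ⟨I, j⟩ h
    simp only [mem_sigma, mem_filter, mem_univ, true_and, mem_compl] at h ⊢
    refine ⟨⟨mem_insert_of_mem h.1.1, by rw [card_insert_of_notMem h.2, h.1.2]⟩, ?_⟩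
    rw [mem_erase]
    exact ⟨fun hj => h.2 (hj ▸ h.1.1), mem_insert_self _ _⟩
  · rintro ⟨J, j⟩ h
    simp only [mem_sigma, mem_filter, mem_univ, true_and, mem_compl, mem_erase] at h ⊢
    refine ⟨⟨⟨fun hj => h.2.1 hj.symm, h.1.1⟩, ?_⟩, by simp⟩
    rw [card_erase_of_mem h.2.2, h.1.2]
    rfl
  · rintro ⟨I, j⟩ h
    simp only [mem_sigma, mem_compl] at h
    simp [erase_insert h.2]
  · rintro ⟨J, j⟩ h
    simp only [mem_sigma, mem_erase] at h
    simp [insert_erase h.2.2]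
  · rintro ⟨I, j⟩ _
    rfl

/-- The family `b` with `b I = F (|I| - 2) (c I + ∑ j ∉ I, b (I ∪ {j}))`. -/
noncomputable def descendingFilling (F : ℕ → CubicalCochain ι → CubicalCochain ι)
    (c : Finset L → CubicalCochain ι) (I : Finset L) : CubicalCochain ι :=
  F (I.card - 2) (c I + ∑ j ∈ Iᶜ.attach, descendingFilling F c (insert j.1 I))
termination_by Iᶜ.card
decreasing_by
  rw [compl_insert]
  exact card_erase_lt_of_mem j.2

theorem exists_residual {n : ℕ} (hn : 0 < n) (c : Finset L → CubicalCochain ι)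
    (hc : ∀ I : Finset L, I.Nonempty → coboundary (c I) = ∑ j ∈ Iᶜ, c (insert j I))
    (hcp : ∀ I : Finset L, I.Nonempty → IsHomogeneousCochain (I.card - 1) (c I)) :
    ∃ b z : Finset L → CubicalCochain ι, (∀ I, z I = c I + ∑ j ∈ Iᶜ, b (insert j I)) ∧
      (∀ I : Finset L, I.Nonempty → coboundary (z I) = 0) ∧
      ∀ I : Finset L, 2 ≤ I.card →
        (cochainSupport n (b I)).card ≤ n * (cochainSupport n (z I)).card := by
  have hF : ∀ (p : ℕ) (f : CubicalCochain ι), ∃ b, IsHomogeneousCochain (p + 1) f →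
      coboundary f = 0 → coboundary b = f ∧ IsHomogeneousCochain p b ∧
      (cochainSupport n b).card ≤ n * (cochainSupport n f).card := by
    intro p f
    by_cases h : IsHomogeneousCochain (p + 1) f ∧ coboundary f = 0
    · obtain ⟨b, hb⟩ := exists_filling hn p f h.1 h.2
      exact ⟨b, fun _ _ => hb⟩
    · exact ⟨0, fun h1 h2 => (h ⟨h1, h2⟩).elim⟩
  choose F hF using hF
  set b := descendingFilling F c with hb
  set z : Finset L → CubicalCochain ι := fun I => c I + ∑ j ∈ Iᶜ, b (insert j I) with hz
  have hbz : ∀ I, b I = F (I.card - 2) (z I) := by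
    intro I
    rw [hb, descendingFilling, sum_attach Iᶜ fun j => descendingFilling F c (insert j I)]
  have main : ∀ (k : ℕ) (I : Finset L), Iᶜ.card = k → I.Nonempty →
      IsHomogeneousCochain (I.card - 1) (z I) ∧ coboundary (z I) = 0 := by
    intro k
    induction k using Nat.strong_induction_on with
    | _ k ih =>
      intro I hk hI
      have hI1 : 1 ≤ I.card := hI.card_pos
      have hj : ∀ j ∈ Iᶜ, coboundary (b (insert j I)) = z (insert j I) ∧
          IsHomogeneousCochain (I.card - 1) (b (insert j I)) := by
        intro j hj
        have hcard : (insert j I).card = I.card + 1 := card_insert_of_notMem (mem_compl.1 hj)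
        obtain ⟨h1, h2⟩ := ih (insert j I)ᶜ.card
          (by rw [compl_insert, ← hk]; exact card_erase_lt_of_mem hj) (insert j I) rfl
          (insert_nonempty _ _)
        have h3 := hF ((insert j I).card - 2) (z (insert j I)) (by
          rw [hcard] at h1 ⊢
          convert h1 using 1
          omega) h2
        rw [← hbz, hcard] at h3
        exact ⟨h3.1, by convert h3.2.1 using 1; omega⟩
      constructor
      · intro S x hne
        by_contra hS
        refine hne ?_
        simp only [hz, Pi.add_apply, Finset.sum_apply]
        rw [not_imp_comm.1 (hcp I hI S x) hS, zero_add]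
        exact sum_eq_zero fun j h => not_imp_comm.1 ((hj j h).2 S x) hS
      · simp only [hz]
        rw [coboundary_add, coboundary_sum, hc I hI, sum_congr rfl fun j h => (hj j h).1]
        simp only [hz, sum_add_distrib]
        ext S x
        have hsym := sum_sum_erase_eq_zero Iᶜ (fun i j => b (insert j (insert i I)) S x)
          fun i j => by rw [insert_comm]
        simp only [Pi.add_apply, Finset.sum_apply, compl_insert, hsym, add_zero,
          CharTwo.add_self_eq_zero, Pi.zero_apply]
  refine ⟨b, z, fun _ => rfl, fun I hI => (main _ I rfl hI).2, fun I hI => ?_⟩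
  obtain ⟨h1, h2⟩ := main _ I rfl (card_pos.1 (by omega))
  rw [hbz]
  refine (hF _ _ ?_ h2).2.2
  convert h1 using 1
  omega

theorem exists_pow_le_sum_mass {n : ℕ} (hn : 0 < n) (c : Finset L → CubicalCochain ι)
    (hc : ∀ I : Finset L, I.Nonempty → coboundary (c I) = ∑ j ∈ Iᶜ, c (insert j I))
    (hcp : ∀ I : Finset L, I.Nonempty → IsHomogeneousCochain (I.card - 1) (c I))
    (hone : ∑ v, c {v} ∅ 0 = 1) :
    ∃ v, n ^ Fintype.card ι ≤ ∑ p ∈ range (Fintype.card L), p.factorial * n ^ p * mass n c v p := by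
  obtain ⟨b, z, hz, hz0, hbz⟩ := exists_residual hn c hc hcp
  have hrec : ∀ v p, mass n z v p ≤ mass n c v p + (p + 1) * n * mass n z v (p + 1) := by
    intro v p
    calc mass n z v p ≤ ∑ I with v ∈ I ∧ I.card = p + 1, ((cochainSupport n (c I)).card +
          ∑ j ∈ Iᶜ, (cochainSupport n (b (insert j I))).card) := by
          refine sum_le_sum fun I _ => ?_
          rw [hz]
          exact (card_cochainSupport_add_le _ _ _).trans
            (by gcongr; exact card_cochainSupport_sum_le _ _ _)
      _ = mass n c v p + (p + 1) * mass n b v (p + 1) := by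
          rw [sum_add_distrib, sum_sum_compl_insert v p fun J => (cochainSupport n (b J)).card]
          rfl
      _ ≤ mass n c v p + (p + 1) * (n * mass n z v (p + 1)) := by
          gcongr
          rw [mass, mass, mul_sum]
          refine sum_le_sum fun I hI => hbz I ?_
          simp only [mem_filter, mem_univ, true_and] at hI
          omega
      _ = _ := by ring
  have hiter : ∀ v q, mass n z v 0 ≤
      ∑ p ∈ range q, p.factorial * n ^ p * mass n c v p + q.factorial * n ^ q * mass n z v q := by
    intro v q
    induction q with
    | zero => simp
    | succ q ih =>
      refine ih.trans ?_
      rw [sum_range_succ, add_assoc]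
      gcongr
      refine (Nat.mul_le_mul_left _ (hrec v q)).trans_eq ?_
      rw [Nat.factorial_succ]
      ring
  have hsum : ∑ v, z {v} ∅ 0 ≠ 0 := by
    have hsym := sum_sum_erase_eq_zero (univ : Finset L) (fun i j => b {j, i} ∅ 0)
      fun i j => by rw [pair_comm]
    have : ∑ v, z {v} ∅ 0 = 1 := by
      simp only [hz, Pi.add_apply, Finset.sum_apply, sum_add_distrib, hone, compl_singleton,
        add_eq_left]
      convert hsym using 4
    rw [this]
    exact one_ne_zero
  obtain ⟨v, -, hv⟩ := exists_ne_zero_of_sum_ne_zero hsum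
  refine ⟨v, ?_⟩
  have hlast : mass n z v (Fintype.card L) = 0 := by
    refine sum_eq_zero fun I hI => ?_
    simp only [mem_filter, mem_univ, true_and] at hI
    have := I.card_le_univ
    omega
  have h := hiter v (Fintype.card L)
  rw [hlast, mul_zero, add_zero] at h
  refine le_trans ?_ h
  calc n ^ Fintype.card ι = (({∅} : Finset (Finset ι)) ×ˢ
        Fintype.piFinset fun _ : ι => range n).card := by simp
    _ ≤ (cochainSupport n (z {v})).card := by
        refine card_le_card fun q hq => ?_
        simp only [mem_product, mem_singleton, Fintype.mem_piFinset, mem_range] at hq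
        rw [mem_cochainSupport, hq.1,
          eq_apply_zero_of_coboundary_eq_zero (hz0 {v} (singleton_nonempty v))]
        exact ⟨hq.2, hv⟩
    _ ≤ mass n z v 0 := by
        refine single_le_sum (f := fun I => (cochainSupport n (z I)).card)
          (fun _ _ => Nat.zero_le _) ?_
        simp

end Descent

section MassBound

variable {ι L : Type*} [DecidableEq ι] [Fintype ι] [DecidableEq L] [Fintype L]

/-- The faces with a vertex in `A`, of dimension `p`. -/
def facesMeeting (p : ℕ) (A : Finset (ι → ℕ)) : Finset (Finset ι × (ι → ℕ)) :=
  ((powersetCard p univ).sigma fun S : Finset ι => S.powerset ×ˢ A).image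
    fun r => (r.1, fun i => if i ∈ r.2.1 then r.2.2 i - 1 else r.2.2 i)

theorem mem_facesMeeting {p : ℕ} {A : Finset (ι → ℕ)} {S : Finset ι} {x y : ι → ℕ}
    (hS : S.card = p) (hy : y ∈ faceVertices S x) (hyA : y ∈ A) : (S, x) ∈ facesMeeting p A := by
  obtain ⟨T, hT, rfl⟩ := mem_faceVertices.1 hy
  refine mem_image.2 ⟨⟨S, T, fun i => if i ∈ T then x i + 1 else x i⟩, ?_, ?_⟩
  · simpa [hS, hT] using hyA
  · ext i
    · rfl
    · dsimp only
      split_ifs <;> rfl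

theorem card_facesMeeting_le (p : ℕ) (A : Finset (ι → ℕ)) :
    (facesMeeting p A).card ≤ (Fintype.card ι).choose p * (2 ^ p * A.card) := by
  refine card_image_le.trans ?_
  rw [card_sigma]
  have h : ∀ S ∈ powersetCard p (univ : Finset ι), (S.powerset ×ˢ A).card = 2 ^ p * A.card := by
    intro S hS
    rw [card_product, card_powerset, (mem_powersetCard.1 hS).2]
  rw [sum_congr rfl h, sum_const, card_powersetCard, card_univ, smul_eq_mul]

theorem mass_labelCochain_le {n m : ℕ} {ℓ : (ι → ℕ) → L} {v : L} {A : Finset (ι → ℕ)}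
    (hcell : ∀ S x, ((faceVertices S x).image ℓ).card ≤ m + 1)
    (hA : ∀ S x, (∀ i, x i < n) → v ∈ (faceVertices S x).image ℓ → ∃ y ∈ faceVertices S x, y ∈ A)
    (p : ℕ) :
    mass n (fun I => labelCochain ℓ (I.card - 1) I) v p ≤
      (Fintype.card ι).choose p * (2 ^ p * A.card) * m.choose p := by
  set 𝓘 : Finset (Finset L) := {I | v ∈ I ∧ I.card = p + 1} with h𝓘
  set r : Finset L → Finset ι × (ι → ℕ) → Prop := fun I q =>
    q ∈ cochainSupport n (labelCochain ℓ (I.card - 1) I) with hr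
  have hmem : ∀ I q, I ∈ 𝓘 → r I q → (v ∈ I ∧ I.card = p + 1) ∧ (∀ i, q.2 i < n) ∧
      q.1.card = p ∧ I ⊆ (faceVertices q.1 q.2).image ℓ := by
    intro I q hI hq
    simp only [h𝓘, mem_filter, mem_univ, true_and] at hI
    obtain ⟨h1, h2⟩ := mem_cochainSupport.1 hq
    obtain ⟨h3, -, h4⟩ := labelCochain_ne_zero h2
    exact ⟨hI, h1, by omega, h4⟩
  have h1 : ∀ I ∈ 𝓘, (cochainSupport n (labelCochain ℓ (I.card - 1) I)).card ≤
      (bipartiteAbove r (facesMeeting p A) I).card := by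
    intro I hI
    refine card_le_card fun q hq => ?_
    obtain ⟨⟨hv, -⟩, hx, hS, hsub⟩ := hmem I q hI hq
    obtain ⟨y, hy, hyA⟩ := hA _ _ hx (hsub hv)
    exact mem_bipartiteAbove r |>.2 ⟨mem_facesMeeting hS hy hyA, hq⟩
  have h2 : ∀ q ∈ facesMeeting p A, (bipartiteBelow r 𝓘 q).card ≤ m.choose p := by
    intro q _
    rcases (bipartiteBelow r 𝓘 q).eq_empty_or_nonempty with h | ⟨I₀, hI₀⟩
    · simp [h]
    · obtain ⟨hI₀, hrI₀⟩ := (mem_bipartiteBelow r).1 hI₀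
      obtain ⟨⟨hv, -⟩, -, -, hsub⟩ := hmem I₀ q hI₀ hrI₀
      have hvm := hsub hv
      calc (bipartiteBelow r 𝓘 q).card
          ≤ (powersetCard p (((faceVertices q.1 q.2).image ℓ).erase v)).card := by
            refine card_le_card_of_injOn (fun I => I.erase v) ?_ ?_
            · intro I hI
              obtain ⟨hI, hrI⟩ := (mem_bipartiteBelow r).1 hI
              obtain ⟨⟨hvI, hcard⟩, -, -, hsubI⟩ := hmem I q hI hrI
              refine mem_powersetCard.2 ⟨erase_subset_erase _ hsubI, ?_⟩
              rw [card_erase_of_mem hvI, hcard]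
              rfl
            · intro I hI J hJ hIJ
              obtain ⟨hI, hrI⟩ := (mem_bipartiteBelow r).1 hI
              obtain ⟨hJ, hrJ⟩ := (mem_bipartiteBelow r).1 hJ
              have h3 := (hmem I q hI hrI).1.1
              have h4 := (hmem J q hJ hrJ).1.1
              rw [← insert_erase h3, ← insert_erase h4]
              exact congrArg (insert v) hIJ
        _ ≤ m.choose p := by
            rw [card_powersetCard, card_erase_of_mem hvm]
            exact Nat.choose_le_choose p (by have := hcell q.1 q.2; omega)
  calc mass n (fun I => labelCochain ℓ (I.card - 1) I) v p
      ≤ ∑ I ∈ 𝓘, (bipartiteAbove r (facesMeeting p A) I).card := sum_le_sum h1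
    _ = ∑ q ∈ facesMeeting p A, (bipartiteBelow r 𝓘 q).card :=
        sum_card_bipartiteAbove_eq_sum_card_bipartiteBelow r
    _ ≤ (facesMeeting p A).card * m.choose p := sum_le_card_nsmul _ _ _ h2
    _ ≤ _ := Nat.mul_le_mul_right _ (card_facesMeeting_le p A)

theorem exists_pow_le_sum_mul_card {n m : ℕ} (hn : 0 < n) (ℓ : (ι → ℕ) → L)
    (A : L → Finset (ι → ℕ))
    (hcell : ∀ S x, ((faceVertices S x).image ℓ).card ≤ m + 1)
    (hA : ∀ v S x, (∀ i, x i < n) → v ∈ (faceVertices S x).image ℓ →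
      ∃ y ∈ faceVertices S x, y ∈ A v) :
    ∃ v, n ^ Fintype.card ι ≤ (∑ p ∈ range (m + 1),
      p.factorial * (Fintype.card ι).choose p * 2 ^ p * m.choose p * n ^ p) * (A v).card := by
  obtain ⟨v, hv⟩ := exists_pow_le_sum_mass hn (fun I => labelCochain ℓ (I.card - 1) I)
    (by
      intro I hI
      rw [coboundary_labelCochain]
      refine sum_congr rfl fun j hj => ?_
      rw [card_insert_of_notMem (mem_compl.1 hj), Nat.sub_add_cancel hI.card_pos,
        Nat.add_sub_cancel])
    (fun I _ S x h => (labelCochain_ne_zero h).1)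
    (by simpa using sum_labelCochain_zero ℓ (0 : ι → ℕ))
  refine ⟨v, hv.trans ?_⟩
  rw [sum_mul]
  calc _ ≤ ∑ p ∈ range (Fintype.card L),
        p.factorial * (Fintype.card ι).choose p * 2 ^ p * m.choose p * n ^ p * (A v).card := by
        refine sum_le_sum fun p _ => ?_
        refine (Nat.mul_le_mul_left _ (mass_labelCochain_le hcell (hA v) p)).trans_eq ?_
        ring
    _ ≤ _ := by
        refine sum_le_sum_of_ne_zero fun p _ hp => ?_
        rw [mem_range]
        by_contra h
        exact hp (by rw [Nat.choose_eq_zero_of_lt (show m < p by omega)]; simp)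

end MassBound

section Coloring

variable {d n : ℕ} {α : Type*} {χ : (Fin d → Fin n) → α}

theorem monoComponent_eq_of_mem {a b : Fin d → Fin n} (h : b ∈ monoComponent χ a) :
    monoComponent χ b = monoComponent χ a := by
  have : Std.Symm fun x y : Fin d → Fin n => cubeAdj x y ∧ χ x = χ y :=
    ⟨fun x y h => ⟨fun i => (h.1 i).symm, h.2.symm⟩⟩
  have h' : Relation.ReflTransGen (fun x y => cubeAdj x y ∧ χ x = χ y) b a :=
    Relation.ReflTransGen.stdSymm.symm _ _ h
  ext c
  exact ⟨fun hc => Relation.ReflTransGen.trans h hc, fun hc => Relation.ReflTransGen.trans h' hc⟩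

theorem monoComponent_eq_of_cubeAdj {a b : Fin d → Fin n} (hab : cubeAdj a b) (hχ : χ a = χ b) :
    monoComponent χ a = monoComponent χ b :=
  (monoComponent_eq_of_mem (Relation.ReflTransGen.single ⟨hab, hχ⟩)).symm

/-- The nearest point of `{0, …, n-1}^d`. -/
def clampToCube (hn : 0 < n) (x : Fin d → ℕ) : Fin d → Fin n := fun i =>
  ⟨min (x i) (n - 1), by omega⟩

theorem cubeAdj_clampToCube (hn : 0 < n) {S : Finset (Fin d)} {x y z : Fin d → ℕ}
    (hy : y ∈ faceVertices S x) (hz : z ∈ faceVertices S x) :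
    cubeAdj (clampToCube hn y) (clampToCube hn z) := by
  obtain ⟨T, -, rfl⟩ := mem_faceVertices.1 hy
  obtain ⟨T', -, rfl⟩ := mem_faceVertices.1 hz
  intro i
  simp only [clampToCube]
  split_ifs <;> omega

theorem clampToCube_mem_faceVertices (hn : 0 < n) {S : Finset (Fin d)} {x y : Fin d → ℕ}
    (hx : ∀ i, x i < n) (hy : y ∈ faceVertices S x) :
    (fun i => (clampToCube hn y i : ℕ)) ∈ faceVertices S x := by
  obtain ⟨T, hT, rfl⟩ := mem_faceVertices.1 hy
  refine mem_faceVertices.2 ⟨T.filter fun i => x i + 1 < n, (filter_subset _ _).trans hT, ?_⟩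
  ext i
  have := hx i
  simp only [clampToCube, mem_filter]
  grind

theorem card_image_le_of_factor {β γ κ : Type*} [DecidableEq γ] [Fintype κ] (V : Finset β)
    (f : β → γ) (g : β → κ) (h : ∀ x ∈ V, ∀ y ∈ V, g x = g y → f x = f y) :
    (V.image f).card ≤ Fintype.card κ := by
  obtain ⟨W, hW, hinj, himg⟩ := exists_subset_injOn_image_eq_of_surjOn (f := f) (V : Set β)
    (V.image f) (by rw [coe_image]; exact Set.surjOn_image f V)
  rw [← himg]
  refine card_image_le.trans (card_le_card_of_injOn (t := univ) g (fun _ _ => mem_univ _) ?_)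
  exact fun x hx y hy hxy => hinj hx hy (h x (hW hx) y (hW hy) hxy)

theorem exists_monoComponent_pow_le {m : ℕ} (hn : 0 < n) (χ : (Fin d → Fin n) → Fin (m + 1)) :
    ∃ a, n ^ d ≤ (∑ p ∈ range (m + 1),
      p.factorial * d.choose p * 2 ^ p * m.choose p * n ^ p) * (monoComponent χ a).ncard := by
  classical
  let toNat : (Fin d → Fin n) → Fin d → ℕ := fun y i => y i
  obtain ⟨v, hv⟩ := exists_pow_le_sum_mul_card (m := m) hn
    (fun x => monoComponent χ (clampToCube hn x))
    (fun v => (univ.filter fun y => monoComponent χ y = v).image toNat)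
    (fun S x => by
      refine (card_image_le_of_factor _ _ (fun y => χ (clampToCube hn y)) ?_).trans_eq
        (Fintype.card_fin _)
      exact fun y hy z hz h => monoComponent_eq_of_cubeAdj (cubeAdj_clampToCube hn hy hz) h)
    (fun v S x hx hvx => by
      obtain ⟨y, hy, hyv⟩ := mem_image.1 hvx
      refine ⟨_, clampToCube_mem_faceVertices hn hx hy, mem_image.2 ⟨clampToCube hn y, ?_, rfl⟩⟩
      simpa using hyv)
  rw [Fintype.card_fin] at hv
  have hle := hv.trans (Nat.mul_le_mul_left _ card_image_le)
  have hpos : 0 < (univ.filter fun y => monoComponent χ y = v).card := by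
    by_contra h
    rw [Nat.eq_zero_of_not_pos h, mul_zero] at hle
    exact (pow_pos hn d).not_ge hle
  obtain ⟨a, ha⟩ := card_pos.1 hpos
  refine ⟨a, hle.trans (Nat.mul_le_mul_left _ ?_)⟩
  rw [← Set.ncard_coe_finset]
  refine Set.ncard_le_ncard (fun y hy => ?_) (Set.toFinite _)
  simp only [coe_filter, mem_univ, true_and, Set.mem_ofPred_eq, mem_filter] at hy ha
  rw [ha, ← hy]
  exact Relation.ReflTransGen.refl

end Coloring

theorem exists_sum_le_factorial_mul_pow (d m : ℕ) (hm : m < d) :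
    ∃ N, ∀ n, N ≤ n → ∑ p ∈ range (m + 1),
      p.factorial * d.choose p * 2 ^ p * m.choose p * n ^ p ≤
        (m + 1).factorial * d.choose m * 4 ^ m * n ^ m := by
  rcases Nat.eq_zero_or_pos m with rfl | hm0
  · exact ⟨0, fun n _ => by simp⟩
  refine ⟨∑ p ∈ range m, p.factorial * d.choose p * 2 ^ p * m.choose p + 1, fun n hn => ?_⟩
  have hlow : ∑ p ∈ range m, p.factorial * d.choose p * 2 ^ p * m.choose p * n ^ p ≤ n ^ m := by
    calc _ ≤ ∑ p ∈ range m, p.factorial * d.choose p * 2 ^ p * m.choose p * n ^ (m - 1) := by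
          refine sum_le_sum fun p hp => Nat.mul_le_mul_left _ (Nat.pow_le_pow_right (by omega) ?_)
          have := mem_range.1 hp
          omega
      _ ≤ n * n ^ (m - 1) := by
          rw [← sum_mul]
          exact Nat.mul_le_mul_right _ (by omega)
      _ = n ^ m := by rw [← pow_succ', Nat.sub_add_cancel hm0]
  have hpos : 0 < m.factorial * d.choose m * 2 ^ m :=
    Nat.mul_pos (Nat.mul_pos m.factorial_pos (Nat.choose_pos hm.le)) (by positivity)
  have h24 : 2 ^ m ≤ 4 ^ m := Nat.pow_le_pow_left (by norm_num) m
  have hlead : 1 + m.factorial * d.choose m * 2 ^ m ≤ (m + 1).factorial * d.choose m * 4 ^ m :=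
    calc _ ≤ (m + 1) * (m.factorial * d.choose m * 2 ^ m) := by nlinarith
      _ = (m + 1).factorial * d.choose m * 2 ^ m := by rw [Nat.factorial_succ]; ring
      _ ≤ _ := Nat.mul_le_mul_left _ h24
  rw [sum_range_succ, Nat.choose_self, mul_one]
  calc _ ≤ n ^ m + m.factorial * d.choose m * 2 ^ m * n ^ m := Nat.add_le_add_right hlow _
    _ = (1 + m.factorial * d.choose m * 2 ^ m) * n ^ m := by ring
    _ ≤ _ := Nat.mul_le_mul_right _ hlead

end CubeColoring

/-- For all large enough `n`, every coloring of the `n^d` small cubes of the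
standard partition of `[0,1]^d` in `m + 1` colors (with `m < d`) has a
monochromatic connected component with at least
`n^(d-m) / ((m+1)! · C(d,m) · 4^m)` small cubes. -/
theorem cube_coloring_explicit_constant (d m : ℕ) (hd : 1 ≤ d) (hm : m < d) :
    ∃ N : ℕ, ∀ n : ℕ, N ≤ n → ∀ χ : (Fin d → Fin n) → Fin (m + 1),
      ∃ a : Fin d → Fin n,
        (n : ℝ) ^ (d - m) / ((Nat.factorial (m + 1) : ℝ) * (Nat.choose d m : ℝ) * 4 ^ m) ≤
          ((monoComponent χ a).ncard : ℝ) := by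
  obtain ⟨N, hN⟩ := exists_sum_le_factorial_mul_pow d m hm
  refine ⟨N + 1, fun n hn χ => ?_⟩
  have hn0 : 0 < n := by omega
  obtain ⟨a, ha⟩ := exists_monoComponent_pow_le hn0 χ
  refine ⟨a, ?_⟩
  have hle : n ^ m * n ^ (d - m) ≤ n ^ m *
      ((monoComponent χ a).ncard * ((m + 1).factorial * d.choose m * 4 ^ m)) := by
    rw [← pow_add, Nat.add_sub_cancel' hm.le]
    refine (ha.trans (Nat.mul_le_mul_right _ (hN n (by omega)))).trans_eq ?_
    ring
  have hle' := Nat.le_of_mul_le_mul_left hle (pow_pos hn0 m)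
  have hpos : (0 : ℝ) < (Nat.factorial (m + 1) : ℝ) * (Nat.choose d m : ℝ) * 4 ^ m := by
    have := Nat.choose_pos hm.le
    positivity
  rw [div_le_iff₀ hpos]
  exact_mod_cast hle'
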